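/- arXiv:2010.00880 — 8 statements merged into one kernel-verified Lean document; each statement's English description precedes it below -/
import Mathlib

section
/- Let d be an even positive integer and let T be a subgroup of SL₂(ℂ) of order 24 with −I₂ ∈ T and center Z(T) = {I₂, −I₂}. If A is a finite group admitting an injective group homomorphism into the subgroup of GL₂(ℂ) generated by μ_d and T, then |A| ≤ 12·|Z(A)|. In particular, no finite group A with |A| = 48 and |Z(A)| = 2 (such as the binary octahedral group), and no finite group A with |A| = 120 and |Z(A)| = 2 (such as the binary icosahedral group), is isomorphic to a subgroup of μ_d·T. -/
open Matrix

/-- The subgroup of `GL₂(ℂ)` consisting of the scalar matrices `ζ • I₂` with `ζ ^ d = 1`. -/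
noncomputable def mu (d : ℕ) : Subgroup (GL (Fin 2) ℂ) :=
  (rootsOfUnity d ℂ).map (Units.map (Matrix.scalar (Fin 2)).toMonoidHom)

theorem normal_of_le_center {G : Type*} [Group G] {N : Subgroup G}
    (hN : N ≤ Subgroup.center G) : N.Normal :=
  ⟨fun n hn g => by rwa [Subgroup.mem_center_iff.mp (hN hn) g, mul_inv_cancel_right]⟩

theorem mu_le_center (d : ℕ) : mu d ≤ Subgroup.center (GL (Fin 2) ℂ) := by
  rintro _ ⟨u, -, rfl⟩
  refine Subgroup.mem_center_iff.mpr fun g => Units.ext ?_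
  exact (Matrix.scalar_commute (u : ℂ) (fun r => Commute.all _ r) (g : Matrix (Fin 2) (Fin 2) ℂ)).symm.eq

theorem neg_one_mem_mu {d : ℕ} (hd : Even d) : (-1 : GL (Fin 2) ℂ) ∈ mu d := by
  refine ⟨-1, ?_, Units.ext ?_⟩
  · simpa [mem_rootsOfUnity] using hd.neg_one_pow
  · simp

theorem card_zpowers_neg_one : Nat.card (Subgroup.zpowers (-1 : GL (Fin 2) ℂ)) = 2 := by
  rw [Nat.card_zpowers]
  refine orderOf_eq_prime (by simp) fun h => ?_
  have h₀ : (-1 : ℂ) = 1 := by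
    simpa using congrArg (fun g : GL (Fin 2) ℂ => (g : Matrix (Fin 2) (Fin 2) ℂ) 0 0) h
  norm_num at h₀

theorem relIndex_mu_dvd {d : ℕ} (hd : Even d) {T : Subgroup (GL (Fin 2) ℂ)}
    (hcard : Nat.card T = 24) (hneg : (-1 : GL (Fin 2) ℂ) ∈ T) : (mu d).relIndex T ∣ 12 := by
  have hmul : Nat.card (Subgroup.zpowers (-1 : GL (Fin 2) ℂ)) *
      (Subgroup.zpowers (-1 : GL (Fin 2) ℂ)).relIndex T = Nat.card T := by
    simpa only [Subgroup.relIndex_bot_left] using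
      Subgroup.relIndex_mul_relIndex ⊥ _ T bot_le (Subgroup.zpowers_le.mpr hneg)
  rw [card_zpowers_neg_one, hcard] at hmul
  have h12 : (Subgroup.zpowers (-1 : GL (Fin 2) ℂ)).relIndex T = 12 := by omega
  exact h12 ▸ Subgroup.relIndex_dvd_of_le_left T (Subgroup.zpowers_le.mpr (neg_one_mem_mu hd))

/-- A group embedding into a group with a central subgroup `N` of finite index has centre of
index at most that of `N`. -/
theorem index_center_le_of_injective {A G : Type*} [Group A] [Group G] {φ : A →* G}
    (hφ : Function.Injective φ) {N : Subgroup G} (hN : N ≤ Subgroup.center G)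
    (hfin : N.index ≠ 0) : (Subgroup.center A).index ≤ N.index := by
  have hle : N.comap φ ≤ Subgroup.center A := fun a ha =>
    Subgroup.mem_center_iff.mpr fun b => hφ <| by
      simpa using Subgroup.mem_center_iff.mp (hN ha) (φ b)
  have := normal_of_le_center hN
  have hdvd : (N.comap φ).index ∣ N.index := by
    rw [Subgroup.index_comap]
    exact Subgroup.relIndex_dvd_index_of_normal N φ.range
  exact Nat.le_of_dvd (Nat.pos_of_ne_zero hfin) ((Subgroup.index_dvd_of_le hle).trans hdvd)

/-- Let `d` be an even positive integer and `T ≤ SL₂(ℂ)` of order `24` with `-I₂ ∈ T`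
and centre `{I₂, -I₂}`.  Every finite group `A` embedding into `μ_d T` satisfies
`|A| ≤ 12 |Z(A)|`; in particular no finite group with `|A| = 48, |Z(A)| = 2` (such as
the binary octahedral group) and no finite group with `|A| = 120, |Z(A)| = 2` (such as
the binary icosahedral group) embeds into `μ_d T`. -/
theorem card_le_of_embeds_mu_T (d : ℕ) (hd : 0 < d) (hdeven : Even d)
    (T : Subgroup (GL (Fin 2) ℂ))
    (hT : ∀ g ∈ T, (g : Matrix (Fin 2) (Fin 2) ℂ).det = 1)
    (hcard : Nat.card T = 24)
    (hnegT : (-1 : GL (Fin 2) ℂ) ∈ T)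
    (hZT : ∀ g ∈ T, (∀ h ∈ T, g * h = h * g) ↔ (g = 1 ∨ g = -1)) :
    (∀ (A : Type) [Group A] [Finite A] (φ : A →* ↥(mu d ⊔ T)),
      Function.Injective φ → Nat.card A ≤ 12 * Nat.card (Subgroup.center A)) ∧
    (∀ (A : Type) [Group A] [Finite A],
      ((Nat.card A = 48 ∧ Nat.card (Subgroup.center A) = 2) ∨
        (Nat.card A = 120 ∧ Nat.card (Subgroup.center A) = 2)) →
      ∀ φ : A →* ↥(mu d ⊔ T), ¬ Function.Injective φ) := by
  have key : ∀ (A : Type) [Group A] [Finite A] (φ : A →* ↥(mu d ⊔ T)),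
      Function.Injective φ → Nat.card A ≤ 12 * Nat.card (Subgroup.center A) := by
    intro A _ _ φ hφ
    have hdvd : ((mu d).subgroupOf (mu d ⊔ T)).index ∣ 12 := by
      have := normal_of_le_center (mu_le_center d)
      change (mu d).relIndex (mu d ⊔ T) ∣ 12
      rw [Subgroup.relIndex_sup_left]
      exact relIndex_mu_dvd hdeven hcard hnegT
    have hcentral : (mu d).subgroupOf (mu d ⊔ T) ≤ Subgroup.center ↥(mu d ⊔ T) := fun a ha =>
      Subgroup.mem_center_iff.mpr fun b =>
        Subtype.ext (Subgroup.mem_center_iff.mp (mu_le_center d ha) b)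
    have hle := (index_center_le_of_injective hφ hcentral
      (ne_zero_of_dvd_ne_zero (by norm_num) hdvd)).trans (Nat.le_of_dvd (by norm_num) hdvd)
    rw [← (Subgroup.center A).index_mul_card]
    exact Nat.mul_le_mul_right _ hle
  refine ⟨key, fun A _ _ hA φ hφ => ?_⟩
  have := key A φ hφ
  omega
end

section
/- Let G be a subgroup of GL₂(ℂ) such that det(g)·I₂ ∈ G for every g ∈ G. Then G^∨ := {g^∨ : g ∈ G} is a normal subgroup of the subgroup H of GL₄(ℂ) generated by G^∨ and s, and moreover H = {g^∨ : g ∈ G} ∪ {g^∨ · s : g ∈ G}. -/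
open Matrix

/-- For a 2×2 matrix `g`, the block-diagonal 4×4 matrix `g^∨ = diag(g, (gᵀ)⁻¹)`. -/
noncomputable def vee (g : Matrix (Fin 2) (Fin 2) ℂ) : Matrix (Fin 4) (Fin 4) ℂ :=
  (Matrix.fromBlocks g 0 0 gᵀ⁻¹).submatrix
    ⇑(finSumFinEquiv (m := 2) (n := 2)).symm ⇑(finSumFinEquiv (m := 2) (n := 2)).symm

/-- The matrix `s`, with `s₁₄ = s₄₁ = 1`, `s₂₃ = s₃₂ = -1` and all other entries `0`. -/
def sMat : Matrix (Fin 4) (Fin 4) ℂ :=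
  !![0,0,0,1; 0,0,-1,0; 0,-1,0,0; 1,0,0,0]

lemma vee_det_ne_zero (g : GL (Fin 2) ℂ) : (vee (g : Matrix (Fin 2) (Fin 2) ℂ)).det ≠ 0 := by
  have hu : IsUnit ((g : Matrix (Fin 2) (Fin 2) ℂ).det) :=
    (Matrix.isUnit_iff_isUnit_det _).mp ⟨g, rfl⟩
  unfold vee
  rw [Matrix.det_submatrix_equiv_self, Matrix.det_fromBlocks_zero₂₁,
    Matrix.det_nonsing_inv, Matrix.det_transpose]
  exact mul_ne_zero hu.ne_zero (by simp [Ring.inverse_eq_inv', inv_ne_zero hu.ne_zero])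

lemma sMat_mul_sMat : sMat * sMat = 1 := by
  ext i j
  fin_cases i <;> fin_cases j <;>
    simp [sMat, Matrix.mul_apply, Fin.sum_univ_succ, Matrix.one_apply]

/-- `g^∨` as an element of `GL₄(ℂ)`. -/
noncomputable def veeGL (g : GL (Fin 2) ℂ) : GL (Fin 4) ℂ :=
  Matrix.GeneralLinearGroup.mkOfDetNeZero (vee (g : Matrix (Fin 2) (Fin 2) ℂ))
    (vee_det_ne_zero g)

/-- `s` as an element of `GL₄(ℂ)`. -/
def sGL : GL (Fin 4) ℂ :=
  ⟨sMat, sMat, sMat_mul_sMat, sMat_mul_sMat⟩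

lemma vee_mul (g h : Matrix (Fin 2) (Fin 2) ℂ) : vee (g * h) = vee g * vee h := by
  unfold vee
  rw [Matrix.submatrix_mul_equiv, Matrix.fromBlocks_multiply]
  simp [Matrix.transpose_mul, Matrix.mul_inv_rev]

/-- The homomorphism `g ↦ g^∨` from `GL₂(ℂ)` to `GL₄(ℂ)`. -/
noncomputable def veeHom : GL (Fin 2) ℂ →* GL (Fin 4) ℂ :=
  MonoidHom.mk' veeGL fun g h => Units.ext (vee_mul g h)

lemma vee_eq (A : Matrix (Fin 2) (Fin 2) ℂ) :
    vee A = !![A 0 0, A 0 1, 0, 0; A 1 0, A 1 1, 0, 0;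
      0, 0, A.det⁻¹ * A 1 1, -(A.det⁻¹ * A 1 0); 0, 0, -(A.det⁻¹ * A 0 1), A.det⁻¹ * A 0 0] := by
  have e0 : (finSumFinEquiv (m := 2) (n := 2)).symm 0 = Sum.inl 0 := rfl
  have e1 : (finSumFinEquiv (m := 2) (n := 2)).symm 1 = Sum.inl 1 := rfl
  have e2 : (finSumFinEquiv (m := 2) (n := 2)).symm 2 = Sum.inr 0 := rfl
  have e3 : (finSumFinEquiv (m := 2) (n := 2)).symm 3 = Sum.inr 1 := rfl
  ext i j
  fin_cases i <;> fin_cases j <;>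
    simp [vee, e0, e1, e2, e3, Matrix.inv_def, Matrix.adjugate_fin_two, Matrix.det_transpose]

lemma sMat_mul_vee (A : Matrix (Fin 2) (Fin 2) ℂ) (hA : A.det ≠ 0) :
    sMat * vee A = vee (A.det⁻¹ • A) * sMat := by
  rw [vee_eq, vee_eq, Matrix.det_smul]
  ext i j
  fin_cases i <;> fin_cases j <;>
    simp [sMat, Matrix.mul_apply, Fin.sum_univ_succ] <;> field_simp

lemma exists_sGL_mul_veeHom {G : Subgroup (GL (Fin 2) ℂ)}
    (hdet : ∀ g ∈ G, ∃ h ∈ G,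
      (h : Matrix (Fin 2) (Fin 2) ℂ)
        = (g : Matrix (Fin 2) (Fin 2) ℂ).det • (1 : Matrix (Fin 2) (Fin 2) ℂ))
    {g : GL (Fin 2) ℂ} (hg : g ∈ G) :
    ∃ g' ∈ G, sGL * veeHom g = veeHom g' * sGL := by
  obtain ⟨h, hh, hd⟩ := hdet g hg
  have hg0 : (g : Matrix (Fin 2) (Fin 2) ℂ).det ≠ 0 :=
    ((Matrix.isUnit_iff_isUnit_det _).mp g.isUnit).ne_zero
  have hinv : ((h⁻¹ * g : GL (Fin 2) ℂ) : Matrix (Fin 2) (Fin 2) ℂ)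
      = (g : Matrix (Fin 2) (Fin 2) ℂ).det⁻¹ • (g : Matrix (Fin 2) (Fin 2) ℂ) := by
    rw [Units.val_mul, Units.inv_mul_eq_iff_eq_mul, hd]
    simp [smul_smul, hg0]
  refine ⟨h⁻¹ * g, G.mul_mem (G.inv_mem hh) hg, Units.ext ?_⟩
  change sMat * vee g = vee ((h⁻¹ * g : GL (Fin 2) ℂ) : Matrix (Fin 2) (Fin 2) ℂ) * sMat
  rw [hinv, sMat_mul_vee _ hg0]

/-- Let `G ≤ GL₂(ℂ)` satisfy `det(g) • I₂ ∈ G` for every `g ∈ G`.  Then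
`G^∨ = {g^∨ : g ∈ G}` is a normal subgroup of the subgroup `H` of `GL₄(ℂ)` generated by
`G^∨` and `s`, and `H = {g^∨ : g ∈ G} ∪ {g^∨ · s : g ∈ G}`. -/
theorem vee_normal_in_EG (G : Subgroup (GL (Fin 2) ℂ))
    (hdet : ∀ g ∈ G, ∃ h ∈ G,
      (h : Matrix (Fin 2) (Fin 2) ℂ)
        = (g : Matrix (Fin 2) (Fin 2) ℂ).det • (1 : Matrix (Fin 2) (Fin 2) ℂ)) :
    (∀ h ∈ Subgroup.closure (veeGL '' (G : Set (GL (Fin 2) ℂ)) ∪ {sGL}),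
      ∀ g ∈ G, h * veeGL g * h⁻¹ ∈ veeGL '' (G : Set (GL (Fin 2) ℂ))) ∧
    ((Subgroup.closure (veeGL '' (G : Set (GL (Fin 2) ℂ)) ∪ {sGL}) : Set (GL (Fin 4) ℂ))
      = veeGL '' (G : Set (GL (Fin 2) ℂ)) ∪ (fun g => veeGL g * sGL) '' (G : Set (GL (Fin 2) ℂ))) := by
  have hs : sGL * sGL = 1 := Units.ext sMat_mul_sMat
  have hsi : sGL⁻¹ = sGL := inv_eq_of_mul_eq_one_left hs
  change (∀ h ∈ Subgroup.closure (veeHom '' (G : Set (GL (Fin 2) ℂ)) ∪ {sGL}),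
      ∀ g ∈ G, h * veeHom g * h⁻¹ ∈ veeHom '' (G : Set (GL (Fin 2) ℂ))) ∧
    ((Subgroup.closure (veeHom '' (G : Set (GL (Fin 2) ℂ)) ∪ {sGL}) : Set (GL (Fin 4) ℂ))
      = veeHom '' (G : Set (GL (Fin 2) ℂ)) ∪
        (fun g => veeHom g * sGL) '' (G : Set (GL (Fin 2) ℂ)))
  have key : ((Subgroup.closure (veeHom '' (G : Set (GL (Fin 2) ℂ)) ∪ {sGL}) :
      Set (GL (Fin 4) ℂ)) = veeHom '' (G : Set (GL (Fin 2) ℂ)) ∪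
        (fun g => veeHom g * sGL) '' (G : Set (GL (Fin 2) ℂ))) := by
    apply Set.Subset.antisymm
    · intro x hx
      induction hx using Subgroup.closure_induction with
      | mem x hx =>
        rcases hx with hx | rfl
        · exact Or.inl hx
        · exact Or.inr ⟨1, G.one_mem, by simp⟩
      | one => exact Or.inl ⟨1, G.one_mem, map_one _⟩
      | mul x y _ _ hx hy =>
        rcases hx with ⟨a, ha, rfl⟩ | ⟨a, ha, rfl⟩ <;> rcases hy with ⟨b, hb, rfl⟩ | ⟨b, hb, rfl⟩
        · exact Or.inl ⟨a * b, G.mul_mem ha hb, map_mul _ _ _⟩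
        · exact Or.inr ⟨a * b, G.mul_mem ha hb, by simp [mul_assoc]⟩
        · obtain ⟨c, hc, h⟩ := exists_sGL_mul_veeHom hdet hb
          exact Or.inr ⟨a * c, G.mul_mem ha hc, by simp [mul_assoc, h]⟩
        · obtain ⟨c, hc, h⟩ := exists_sGL_mul_veeHom hdet hb
          refine Or.inl ⟨a * c, G.mul_mem ha hc, ?_⟩
          simp only [map_mul, mul_assoc]
          rw [← mul_assoc sGL, h, mul_assoc, hs, mul_one]
      | inv x _ hx =>
        rcases hx with ⟨a, ha, rfl⟩ | ⟨a, ha, rfl⟩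
        · exact Or.inl ⟨a⁻¹, G.inv_mem ha, map_inv _ _⟩
        · obtain ⟨c, hc, h⟩ := exists_sGL_mul_veeHom hdet (G.inv_mem ha)
          exact Or.inr ⟨c, hc, by simp [← h, hsi]⟩
    · have hv : ∀ g ∈ G, veeHom g ∈
          Subgroup.closure (veeHom '' (G : Set (GL (Fin 2) ℂ)) ∪ {sGL}) :=
        fun g hg => Subgroup.subset_closure (Or.inl ⟨g, hg, rfl⟩)
      rintro _ (⟨a, ha, rfl⟩ | ⟨a, ha, rfl⟩)
      · exact hv a ha
      · exact Subgroup.mul_mem _ (hv a ha) (Subgroup.subset_closure (Or.inr rfl))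
  refine ⟨fun h hh g hg => ?_, key⟩
  rw [← SetLike.mem_coe, key] at hh
  rcases hh with ⟨a, ha, rfl⟩ | ⟨a, ha, rfl⟩
  · exact ⟨a * g * a⁻¹, G.mul_mem (G.mul_mem ha hg) (G.inv_mem ha), by simp⟩
  · obtain ⟨c, hc, h⟩ := exists_sGL_mul_veeHom hdet hg
    refine ⟨a * c * a⁻¹, G.mul_mem (G.mul_mem ha hc) (G.inv_mem ha), ?_⟩
    simp only [map_mul, map_inv, _root_.mul_inv_rev]
    rw [mul_assoc (veeHom a) sGL, h]
    group
end

section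
/- For every g ∈ GL₂(ℂ), the rank of the 4×4 matrix I₄ − g^∨·s equals 2 if and only if g is a scalar matrix, i.e. g = η·I₂ for some η ∈ ℂ with η ≠ 0. -/
open Matrix

section BlockRank

variable {K m n o : Type*} [Field K] [Fintype m] [DecidableEq m] [Fintype o]

/-- A block matrix with upper left block `1` has the least possible rank if and only if its
Schur complement vanishes. -/
theorem rank_fromBlocks_one_eq_card_iff (B : Matrix m o K) (C : Matrix n m K)
    (D : Matrix n o K) :
    (fromBlocks 1 B C D).rank = Fintype.card m ↔ D = C * B := by
  classical
  constructor
  · intro h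
    ext i j
    by_contra hne
    have hdet : (fromBlocks (1 : Matrix m m K) (B.submatrix id fun _ : Unit => j)
        (C.submatrix (fun _ : Unit => i) id)
        (D.submatrix (fun _ : Unit => i) fun _ : Unit => j)).det ≠ 0 := by
      rw [det_fromBlocks_one₁₁, det_unique]
      simpa [Matrix.mul_apply, sub_eq_zero] using hne
    have hsub : fromBlocks (1 : Matrix m m K) (B.submatrix id fun _ : Unit => j)
        (C.submatrix (fun _ : Unit => i) id)
        (D.submatrix (fun _ : Unit => i) fun _ : Unit => j) =
        (fromBlocks 1 B C D).submatrix (Sum.map id fun _ => i) (Sum.map id fun _ => j) := by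
      ext (a | a) (b | b) <;> rfl
    have hle := rank_submatrix_le (fromBlocks 1 B C D)
      (Sum.map (id : m → m) fun _ : Unit => i) (Sum.map (id : m → m) fun _ : Unit => j)
    rw [← hsub, rank_of_det_ne_zero hdet, h, Fintype.card_sum, Fintype.card_unit] at hle
    omega
  · rintro rfl
    apply le_antisymm
    · have h : fromBlocks 1 B C (C * B) = fromRows (1 : Matrix m m K) C * fromCols 1 B := by
        rw [fromRows_mul_fromCols]; simp
      rw [h]
      exact (rank_mul_le_left _ _).trans (rank_le_card_width _)
    · have h : (1 : Matrix m m K) = (fromBlocks 1 B C (C * B)).submatrix Sum.inl Sum.inl := by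
        ext; rfl
      rw [← rank_one (n := m) (R := K), h]
      exact rank_submatrix_le _ _ _

end BlockRank

theorem one_sub_vee_mul_sMat (g : Matrix (Fin 2) (Fin 2) ℂ) :
    1 - vee g * sMat =
      (fromBlocks 1 (-(g * !![0, 1; -1, 0])) (gᵀ⁻¹ * !![0, 1; -1, 0]) 1).submatrix
        (finSumFinEquiv (m := 2) (n := 2)).symm (finSumFinEquiv (m := 2) (n := 2)).symm := by
  have hs : sMat = (fromBlocks 0 !![0, 1; -1, 0] (-!![0, 1; -1, 0]) 0).submatrix
      (finSumFinEquiv (m := 2) (n := 2)).symm (finSumFinEquiv (m := 2) (n := 2)).symm := by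
    ext i j
    obtain ⟨i, rfl⟩ := (finSumFinEquiv (m := 2) (n := 2)).surjective i
    obtain ⟨j, rfl⟩ := (finSumFinEquiv (m := 2) (n := 2)).surjective j
    rw [submatrix_apply, Equiv.symm_apply_apply, Equiv.symm_apply_apply]
    rcases i with i | i <;> rcases j with j | j <;> fin_cases i <;> fin_cases j <;>
      simp [sMat, finSumFinEquiv]
  rw [hs, vee, submatrix_mul_equiv, fromBlocks_multiply,
    ← submatrix_one_equiv (finSumFinEquiv (m := 2) (n := 2)).symm, ← fromBlocks_one]
  refine (congr_fun₂ (submatrix_sub _ _) _ _).symm.trans ?_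
  rw [sub_eq_add_neg, fromBlocks_neg, fromBlocks_add]
  simp only [Matrix.mul_zero, Matrix.zero_mul, Matrix.mul_neg, add_zero, zero_add, neg_zero,
    neg_neg]

/-- An invertible `2 × 2` matrix whose square is its determinant is a scalar matrix. -/
theorem sq_eq_det_smul_one_iff (g : Matrix (Fin 2) (Fin 2) ℂ) (hg : g.det ≠ 0) :
    g * g = g.det • (1 : Matrix (Fin 2) (Fin 2) ℂ) ↔
      ∃ η : ℂ, η ≠ 0 ∧ g = η • (1 : Matrix (Fin 2) (Fin 2) ℂ) := by
  constructor
  · intro h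
    have h00 := congr_fun₂ h 0 0
    have h01 := congr_fun₂ h 0 1
    have h10 := congr_fun₂ h 1 0
    have h11 := congr_fun₂ h 1 1
    simp [Matrix.mul_apply, Fin.sum_univ_two, det_fin_two] at h00 h01 h10 h11
    rw [det_fin_two] at hg
    have ht : g 0 0 + g 1 1 ≠ 0 := by
      intro ht
      apply hg
      linear_combination (1 / 4 : ℂ) * (g 0 0 + g 1 1) * ht - (1 / 4 : ℂ) * (h00 + h11)
    have hb : g 0 1 = 0 := by
      apply (mul_eq_zero.mp _).resolve_left ht
      linear_combination h01
    have hc : g 1 0 = 0 := by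
      apply (mul_eq_zero.mp _).resolve_left ht
      linear_combination h10
    have had : g 0 0 = g 1 1 := by
      apply sub_eq_zero.mp
      apply (mul_eq_zero.mp _).resolve_left ht
      linear_combination h00 - h11
    refine ⟨g 0 0, ?_, ?_⟩
    · intro h0
      apply hg
      rw [h0, hb]; ring
    · ext i j
      fin_cases i <;> fin_cases j <;> simp [hb, hc, had]
  · rintro ⟨η, -, rfl⟩
    simp [smul_smul, sq]

/-- For every `g ∈ GL₂(ℂ)`, `rank(I₄ - g^∨ · s) = 2` if and only if `g` is a nonzero
scalar matrix. -/
theorem rank_one_sub_vee_s (g : GL (Fin 2) ℂ) :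
    (1 - vee (g : Matrix (Fin 2) (Fin 2) ℂ) * sMat).rank = 2
      ↔ ∃ η : ℂ, η ≠ 0 ∧
          (g : Matrix (Fin 2) (Fin 2) ℂ) = η • (1 : Matrix (Fin 2) (Fin 2) ℂ) := by
  have hg : (g : Matrix (Fin 2) (Fin 2) ℂ).det ≠ 0 := g.det.ne_zero
  generalize (g : Matrix (Fin 2) (Fin 2) ℂ) = A at hg ⊢
  have hT : IsUnit (Aᵀ).det := by rw [det_transpose]; exact hg.isUnit
  have hJ : !![0, 1; -1, 0] * (A * !![0, 1; -1, 0]) = -(A.det • Aᵀ⁻¹) := by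
    rw [Matrix.inv_def, det_transpose, Ring.inverse_eq_inv', smul_smul, mul_inv_cancel₀ hg,
      one_smul]
    ext i j
    fin_cases i <;> fin_cases j <;>
      simp [Matrix.mul_apply, Fin.sum_univ_two, adjugate_fin_two]
  have hcard := rank_fromBlocks_one_eq_card_iff (-(A * !![0, 1; -1, 0]))
    (Aᵀ⁻¹ * !![0, 1; -1, 0]) (1 : Matrix (Fin 2) (Fin 2) ℂ)
  rw [Fintype.card_fin] at hcard
  rw [one_sub_vee_mul_sMat, rank_submatrix, hcard, ← sq_eq_det_smul_one_iff A hg,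
    Matrix.mul_assoc, Matrix.mul_neg, hJ, neg_neg, Matrix.mul_smul]
  rw [← transpose_inj (A := A * A), transpose_mul, transpose_smul, transpose_one]
  constructor
  · intro h
    calc Aᵀ * Aᵀ = Aᵀ * (1 * Aᵀ) := by rw [Matrix.one_mul]
      _ = A.det • (Aᵀ * Aᵀ⁻¹ * (Aᵀ⁻¹ * Aᵀ)) := by
        rw [h]; simp only [Matrix.smul_mul, Matrix.mul_smul, Matrix.mul_assoc]
      _ = A.det • 1 := by
        rw [mul_nonsing_inv _ hT, nonsing_inv_mul _ hT, Matrix.one_mul]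
  · intro h
    calc (1 : Matrix (Fin 2) (Fin 2) ℂ) = Aᵀ⁻¹ * (Aᵀ * Aᵀ) * Aᵀ⁻¹ := by
          rw [nonsing_inv_mul_cancel_left _ _ hT, mul_nonsing_inv _ hT]
      _ = A.det • (Aᵀ⁻¹ * Aᵀ⁻¹) := by rw [h]; simp
end

section
/- Let G be a subgroup of GL₂(ℂ) and set E(G) := {g^∨ : g ∈ G} ∪ {g^∨ · s : g ∈ G} ⊆ GL₄(ℂ). Then the set of symplectic reflections in E(G), i.e. {x ∈ E(G) : rank(x − I₄) = 2}, equals the disjoint union {g^∨ : g ∈ G, rank(g − I₂) = 1} ∪ {(η·I₂)^∨ · s : η ∈ ℂ, η ≠ 0, η·I₂ ∈ G}. -/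
open Matrix

/-- The scalar matrix `z • I₂` as an element of `GL₂(ℂ)`. -/
noncomputable def scalarGL (z : ℂˣ) : GL (Fin 2) ℂ :=
  Units.map (Matrix.scalar (Fin 2)).toMonoidHom z

/-- The set `E(G) = {g^∨ : g ∈ G} ∪ {g^∨ · s : g ∈ G} ⊆ GL₄(ℂ)`. -/
noncomputable def EGset (G : Subgroup (GL (Fin 2) ℂ)) : Set (GL (Fin 4) ℂ) :=
  veeGL '' (G : Set (GL (Fin 2) ℂ)) ∪ (fun g => veeGL g * sGL) '' (G : Set (GL (Fin 2) ℂ))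

/-- The product of two submodules is linearly equivalent to their product as types. -/
def Submodule.prodLinearEquiv {R M N : Type*} [Semiring R] [AddCommMonoid M] [AddCommMonoid N]
    [Module R M] [Module R N] (p : Submodule R M) (q : Submodule R N) :
    p.prod q ≃ₗ[R] p × q where
  toFun x := (⟨x.1.1, x.2.1⟩, ⟨x.1.2, x.2.2⟩)
  invFun x := ⟨(x.1.1, x.2.1), x.1.2, x.2.2⟩
  map_add' _ _ := rfl
  map_smul' _ _ := rfl

namespace Matrix

variable {K m n : Type*} [Field K] [Fintype n]

lemma rank_fromBlocks_zero [Fintype m] (A : Matrix m m K) (D : Matrix n n K) :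
    (fromBlocks A 0 0 D).rank = A.rank + D.rank := by
  have h : (LinearMap.range (fromBlocks A 0 0 D).mulVecLin).map
      (LinearEquiv.sumArrowLequivProdArrow m n K K : (m ⊕ n → K) →ₗ[K] (m → K) × (n → K)) =
      (LinearMap.range A.mulVecLin).prod (LinearMap.range D.mulVecLin) := by
    ext ⟨x, y⟩
    simp only [Submodule.mem_map, LinearMap.mem_range, mulVecLin_apply, Submodule.mem_prod,
      exists_exists_eq_and, LinearEquiv.coe_coe, fromBlocks_mulVec, zero_mulVec, add_zero,
      zero_add]
    constructor
    · rintro ⟨v, hv⟩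
      exact ⟨⟨_, congrArg Prod.fst hv⟩, ⟨_, congrArg Prod.snd hv⟩⟩
    · rintro ⟨⟨v, rfl⟩, ⟨w, rfl⟩⟩
      exact ⟨Sum.elim v w, rfl⟩
  rw [rank, rank, rank, ← Module.finrank_prod, ← (Submodule.prodLinearEquiv _ _).finrank_eq, ← h]
  exact (LinearEquiv.finrank_map_eq _ _).symm

protected lemma rank_eq_zero_iff (A : Matrix m n K) : A.rank = 0 ↔ A = 0 := by
  classical
  refine ⟨fun h => ?_, fun h => h ▸ rank_zero⟩
  rw [rank, Submodule.finrank_eq_zero, LinearMap.range_eq_bot] at h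
  exact Matrix.toLin'.injective (by simpa [toLin'_apply'] using h)

lemma rank_fromBlocks_neg_one_neg_one [Fintype m] [DecidableEq m] [DecidableEq n]
    (B : Matrix m n K) (C : Matrix n m K) :
    (fromBlocks (-1) B C (-1)).rank = Fintype.card m + (C * B - 1).rank := by
  have h : fromBlocks (-1) B C (-1) =
      fromBlocks 1 0 (-C) 1 * fromBlocks (-1) 0 0 (C * B - 1) * fromBlocks 1 (-B) 0 1 := by
    simp [fromBlocks_multiply, neg_add_eq_sub]
  have h1 : (-1 : Matrix m m K).rank = Fintype.card m := by
    simpa using rank_unit (-1 : (Matrix m m K)ˣ)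
  rw [h, rank_mul_eq_left_of_isUnit_det _ _ (by simp),
    rank_mul_eq_right_of_isUnit_det _ _ (by simp), rank_fromBlocks_zero, h1]

lemma rank_inv_transpose_sub_one [DecidableEq n] (g : GL n K) :
    ((g : Matrix n n K)ᵀ⁻¹ - 1).rank = ((g : Matrix n n K) - 1).rank := by
  have hu : IsUnit (g : Matrix n n K).det := (isUnit_iff_isUnit_det _).mp g.isUnit
  have hut : IsUnit (g : Matrix n n K)ᵀ.det := by rwa [det_transpose]
  have h : (g : Matrix n n K)ᵀ * ((g : Matrix n n K)ᵀ⁻¹ - 1) = -((g : Matrix n n K) - 1)ᵀ := by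
    rw [mul_sub, mul_nonsing_inv _ hut]
    simp
  rw [← rank_mul_eq_right_of_isUnit_det _ _ hut, h, ← rank_transpose ((g : Matrix n n K) - 1),
    ← rank_mul_eq_right_of_isUnit_det (-1) _ (by simp [det_neg])]
  simp

end Matrix

lemma rank_veeGL_sub_one (g : GL (Fin 2) ℂ) :
    ((veeGL g : Matrix (Fin 4) (Fin 4) ℂ) - 1).rank =
      2 * ((g : Matrix (Fin 2) (Fin 2) ℂ) - 1).rank := by
  let e := (finSumFinEquiv (m := 2) (n := 2)).symm
  have h : (veeGL g : Matrix (Fin 4) (Fin 4) ℂ) - 1 =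
      (fromBlocks ((g : Matrix (Fin 2) (Fin 2) ℂ) - 1) 0 0
        ((g : Matrix (Fin 2) (Fin 2) ℂ)ᵀ⁻¹ - 1)).submatrix e e := by
    have h1 : (1 : Matrix (Fin 4) (Fin 4) ℂ) =
        (1 : Matrix (Fin 2 ⊕ Fin 2) (Fin 2 ⊕ Fin 2) ℂ).submatrix e e := by simp
    change vee _ - 1 = _
    rw [h1, vee, ← fromBlocks_one]
    refine (congrFun₂ (submatrix_sub _ _) e e).symm.trans ?_
    rw [sub_eq_add_neg, fromBlocks_neg, fromBlocks_add]
    simp [sub_eq_add_neg]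
  rw [h, rank_submatrix, rank_fromBlocks_zero, rank_inv_transpose_sub_one, two_mul]

lemma sMat_eq_submatrix : sMat = (fromBlocks 0 !![0, 1; -1, 0] !![0, -1; 1, 0] 0).submatrix
    (finSumFinEquiv (m := 2) (n := 2)).symm (finSumFinEquiv (m := 2) (n := 2)).symm := by
  ext i j
  fin_cases i <;> fin_cases j <;> simp [sMat, finSumFinEquiv, Fin.addCases]

lemma veeGL_mul_sGL (g : GL (Fin 2) ℂ) :
    ((veeGL g * sGL : GL (Fin 4) ℂ) : Matrix (Fin 4) (Fin 4) ℂ) =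
      (fromBlocks 0 ((g : Matrix (Fin 2) (Fin 2) ℂ) * !![0, 1; -1, 0])
        ((g : Matrix (Fin 2) (Fin 2) ℂ)ᵀ⁻¹ * !![0, -1; 1, 0]) 0).submatrix
      (finSumFinEquiv (m := 2) (n := 2)).symm (finSumFinEquiv (m := 2) (n := 2)).symm := by
  change vee g * sMat = _
  rw [sMat_eq_submatrix, vee, submatrix_mul_equiv, fromBlocks_multiply]
  simp

lemma rank_veeGL_mul_sGL_sub_one (g : GL (Fin 2) ℂ) :
    (((veeGL g * sGL : GL (Fin 4) ℂ) : Matrix (Fin 4) (Fin 4) ℂ) - 1).rank = 2 +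
      (((g : Matrix (Fin 2) (Fin 2) ℂ)ᵀ⁻¹ * !![0, -1; 1, 0]) *
        ((g : Matrix (Fin 2) (Fin 2) ℂ) * !![0, 1; -1, 0]) - 1).rank := by
  let e := (finSumFinEquiv (m := 2) (n := 2)).symm
  have h : ((veeGL g * sGL : GL (Fin 4) ℂ) : Matrix (Fin 4) (Fin 4) ℂ) - 1 =
      (fromBlocks (-1) ((g : Matrix (Fin 2) (Fin 2) ℂ) * !![0, 1; -1, 0])
        ((g : Matrix (Fin 2) (Fin 2) ℂ)ᵀ⁻¹ * !![0, -1; 1, 0]) (-1)).submatrix e e := by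
    have h1 : (1 : Matrix (Fin 4) (Fin 4) ℂ) =
        (1 : Matrix (Fin 2 ⊕ Fin 2) (Fin 2 ⊕ Fin 2) ℂ).submatrix e e := by simp
    rw [h1, veeGL_mul_sGL, ← fromBlocks_one]
    refine (congrFun₂ (submatrix_sub _ _) e e).symm.trans ?_
    rw [sub_eq_add_neg, fromBlocks_neg, fromBlocks_add]
    simp
  rw [h, rank_submatrix, rank_fromBlocks_neg_one_neg_one, Fintype.card_fin]

lemma exists_eq_scalarGL_iff (g : GL (Fin 2) ℂ) :
    (∃ η, g = scalarGL η) ↔ g 0 0 = g 1 1 ∧ g 0 1 = 0 ∧ g 1 0 = 0 := by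
  constructor
  · rintro ⟨η, rfl⟩
    simp [scalarGL]
  · rintro ⟨h, h01, h10⟩
    have hd : (g : Matrix (Fin 2) (Fin 2) ℂ).det ≠ 0 :=
      ((isUnit_iff_isUnit_det _).mp g.isUnit).ne_zero
    rw [det_fin_two, h01, zero_mul, sub_zero] at hd
    refine ⟨Units.mk0 (g 0 0) (left_ne_zero_of_mul hd), Units.ext ?_⟩
    ext i j
    fin_cases i <;> fin_cases j <;> simp [scalarGL, h, h01, h10]

/-- The element `g^∨ · s` is a symplectic reflection if and only if `g` is scalar. -/
lemma rank_veeGL_mul_sGL_sub_one_eq_two_iff (g : GL (Fin 2) ℂ) :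
    (((veeGL g * sGL : GL (Fin 4) ℂ) : Matrix (Fin 4) (Fin 4) ℂ) - 1).rank = 2 ↔
      ∃ η, g = scalarGL η := by
  have hut : IsUnit (g : Matrix (Fin 2) (Fin 2) ℂ)ᵀ.det := by
    rw [det_transpose]
    exact (isUnit_iff_isUnit_det _).mp g.isUnit
  have h : (g : Matrix (Fin 2) (Fin 2) ℂ)ᵀ⁻¹ *
      (!![0, -1; 1, 0] * ((g : Matrix (Fin 2) (Fin 2) ℂ) * !![0, 1; -1, 0])) = 1 ↔
      !![0, -1; 1, 0] * ((g : Matrix (Fin 2) (Fin 2) ℂ) * !![0, 1; -1, 0]) =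
        (g : Matrix (Fin 2) (Fin 2) ℂ)ᵀ := by
    constructor
    · intro h
      rw [← mul_nonsing_inv_cancel_left _ (!![0, -1; 1, 0] * _) hut, h, mul_one]
    · intro h
      rw [h, nonsing_inv_mul _ hut]
  rw [rank_veeGL_mul_sGL_sub_one, Nat.add_eq_left, Matrix.rank_eq_zero_iff, sub_eq_zero,
    Matrix.mul_assoc, h, exists_eq_scalarGL_iff, ← Matrix.ext_iff]
  simp only [Fin.forall_fin_two, mul_apply, Fin.sum_univ_two, transpose_apply]
  simp [neg_eq_self]
  grind

lemma veeGL_ne_veeGL_mul_sGL (g h : GL (Fin 2) ℂ) : veeGL g ≠ veeGL h * sGL := by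
  intro hgh
  have hM := congrArg (fun x : GL (Fin 4) ℂ => (x : Matrix (Fin 4) (Fin 4) ℂ)) hgh
  simp only [veeGL_mul_sGL] at hM
  change vee g = _ at hM
  rw [vee, ← reindex_apply, ← reindex_apply] at hM
  replace hM := (reindex finSumFinEquiv finSumFinEquiv).injective hM
  exact g.ne_zero (fromBlocks_inj.mp hM).1

/-- The symplectic reflections in `E(G)` are exactly the `g^∨` with `g ∈ G` a complex
reflection together with the `(η • I₂)^∨ · s` with `η • I₂ ∈ G`, and these two sets of
symplectic reflections are disjoint. -/
theorem symplectic_reflections_of_EG (G : Subgroup (GL (Fin 2) ℂ)) :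
    ({ x ∈ EGset G | ((x : Matrix (Fin 4) (Fin 4) ℂ) - 1).rank = 2 }
      = { x | ∃ g ∈ G, ((g : Matrix (Fin 2) (Fin 2) ℂ) - 1).rank = 1 ∧ x = veeGL g }
        ∪ { x | ∃ η : ℂˣ, scalarGL η ∈ G ∧ x = veeGL (scalarGL η) * sGL }) ∧
    Disjoint
      { x : GL (Fin 4) ℂ | ∃ g ∈ G, ((g : Matrix (Fin 2) (Fin 2) ℂ) - 1).rank = 1 ∧ x = veeGL g }
      { x : GL (Fin 4) ℂ | ∃ η : ℂˣ, scalarGL η ∈ G ∧ x = veeGL (scalarGL η) * sGL } := by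
  refine ⟨?_, Set.disjoint_left.mpr ?_⟩
  · ext x
    constructor
    · rintro ⟨⟨g, hg, rfl⟩ | ⟨g, hg, rfl⟩, hx⟩
      · rw [rank_veeGL_sub_one] at hx
        exact .inl ⟨g, hg, by omega, rfl⟩
      · obtain ⟨η, rfl⟩ := (rank_veeGL_mul_sGL_sub_one_eq_two_iff g).mp hx
        exact .inr ⟨η, hg, rfl⟩
    · rintro (⟨g, hg, hr, rfl⟩ | ⟨η, hη, rfl⟩)
      · exact ⟨.inl ⟨g, hg, rfl⟩, by rw [rank_veeGL_sub_one, hr]⟩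
      · exact ⟨.inr ⟨_, hη, rfl⟩, (rank_veeGL_mul_sGL_sub_one_eq_two_iff _).mpr ⟨η, rfl⟩⟩
  · rintro x ⟨g, -, -, rfl⟩ ⟨η, -, h⟩
    exact veeGL_ne_veeGL_mul_sGL _ _ h
end

section
/- Let G be a subgroup of GL₂(ℂ) with det(g)·I₂ ∈ G for every g ∈ G, and let E(G) be the subgroup {g^∨ : g ∈ G} ∪ {g^∨ · s : g ∈ G} of GL₄(ℂ). Then the conjugacy class of s in E(G) equals {((det g)·I₂)^∨ · s : g ∈ G}. -/
open Matrix

lemma vee_eq_of (g : Matrix (Fin 2) (Fin 2) ℂ) :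
    vee g = !![g 0 0, g 0 1, 0, 0;
               g 1 0, g 1 1, 0, 0;
               0, 0, g.det⁻¹ * g 1 1, -(g.det⁻¹ * g 1 0);
               0, 0, -(g.det⁻¹ * g 0 1), g.det⁻¹ * g 0 0] := by
  have e0 : (finSumFinEquiv (m := 2) (n := 2)).symm 0 = Sum.inl 0 := rfl
  have e1 : (finSumFinEquiv (m := 2) (n := 2)).symm 1 = Sum.inl 1 := rfl
  have e2 : (finSumFinEquiv (m := 2) (n := 2)).symm 2 = Sum.inr 0 := rfl
  have e3 : (finSumFinEquiv (m := 2) (n := 2)).symm 3 = Sum.inr 1 := rfl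
  ext i j
  fin_cases i <;> fin_cases j <;>
    simp [vee, e0, e1, e2, e3, Matrix.inv_def, Matrix.adjugate_fin_two, Ring.inverse_eq_inv']

lemma veeGL_mul_sGL_s15 (g : GL (Fin 2) ℂ) :
    veeGL g * sGL = veeGL (scalarGL (Matrix.GeneralLinearGroup.det g)) * sGL * veeGL g := by
  have hu : (g : Matrix (Fin 2) (Fin 2) ℂ).det ≠ 0 :=
    ((Matrix.isUnit_iff_isUnit_det _).mp ⟨g, rfl⟩).ne_zero
  apply Units.ext
  change vee (g : Matrix (Fin 2) (Fin 2) ℂ) * sMat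
    = vee (Matrix.scalar (Fin 2) (g : Matrix (Fin 2) (Fin 2) ℂ).det) * sMat
      * vee (g : Matrix (Fin 2) (Fin 2) ℂ)
  rw [vee_eq_of, vee_eq_of]
  generalize hD : (g : Matrix (Fin 2) (Fin 2) ℂ).det = D at hu ⊢
  ext i j
  fin_cases i <;> fin_cases j <;>
    simp [sMat, Matrix.mul_apply, Fin.sum_univ_succ, -mul_eq_mul_right_iff] <;> field_simp

lemma veeGL_conj_sGL (g : GL (Fin 2) ℂ) :
    veeGL g * sGL * (veeGL g)⁻¹
      = veeGL (scalarGL (Matrix.GeneralLinearGroup.det g)) * sGL :=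
  mul_inv_eq_of_eq_mul (veeGL_mul_sGL_s15 g)

/-- Let `G ≤ GL₂(ℂ)` with `det(g) • I₂ ∈ G` for all `g ∈ G`, and let `E(G)` be the
subgroup `{g^∨ : g ∈ G} ∪ {g^∨ · s : g ∈ G}` of `GL₄(ℂ)`.  Then the conjugacy class of
`s` in `E(G)` is `{((det g) • I₂)^∨ · s : g ∈ G}`. -/
theorem conjugacy_class_of_s (G : Subgroup (GL (Fin 2) ℂ))
    (hdet : ∀ g ∈ G, scalarGL (Matrix.GeneralLinearGroup.det g) ∈ G)
    (H : Subgroup (GL (Fin 4) ℂ))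
    (hH : (H : Set (GL (Fin 4) ℂ))
      = veeGL '' (G : Set (GL (Fin 2) ℂ)) ∪ (fun g => veeGL g * sGL) '' (G : Set (GL (Fin 2) ℂ))) :
    { x : GL (Fin 4) ℂ | ∃ h ∈ H, x = h * sGL * h⁻¹ }
      = { x : GL (Fin 4) ℂ | ∃ g ∈ G,
            x = veeGL (scalarGL (Matrix.GeneralLinearGroup.det g)) * sGL } := by
  ext x
  constructor
  · rintro ⟨h, hh, rfl⟩
    rw [← SetLike.mem_coe, hH] at hh
    rcases hh with ⟨g, hg, rfl⟩ | ⟨g, hg, rfl⟩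
    · exact ⟨g, hg, veeGL_conj_sGL g⟩
    · refine ⟨g, hg, ?_⟩
      rw [← veeGL_conj_sGL]
      group
  · rintro ⟨g, hg, rfl⟩
    refine ⟨veeGL g, ?_, (veeGL_conj_sGL g).symm⟩
    rw [← SetLike.mem_coe, hH]
    exact Or.inl ⟨g, hg, rfl⟩
end

section
/- Let G be a finite group and N a subgroup of G such that every element of G can be written as z·n with z ∈ Z(G) and n ∈ N. If ρ: G → GL(V) is an irreducible representation of G on a nonzero finite-dimensional complex vector space V, then the restriction of ρ to N is also irreducible. -/
/-- **Schur's lemma** for central elements: a central element acts by a scalar on an irreducible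
finite-dimensional representation over an algebraically closed field. -/
theorem exists_forall_apply_eq_smul_of_mem_center {k G V : Type*} [Field k] [IsAlgClosed k]
    [Group G] [AddCommGroup V] [Module k V] [FiniteDimensional k V] [Nontrivial V]
    (ρ : Representation k G V)
    (hirr : ∀ p : Submodule k V, (∀ g : G, ∀ v ∈ p, ρ g v ∈ p) → p = ⊥ ∨ p = ⊤)
    {z : G} (hz : z ∈ Subgroup.center G) : ∃ c : k, ∀ v, ρ z v = c • v := by
  obtain ⟨c, hc⟩ := Module.End.exists_eigenvalue (ρ z)
  refine ⟨c, fun v => Module.End.mem_eigenspace_iff.mp ?_⟩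
  have htop : Module.End.eigenspace (ρ z) c = ⊤ := by
    refine (hirr _ fun g v hv => ?_).resolve_left hc
    rw [Module.End.mem_eigenspace_iff] at hv ⊢
    rw [← Module.End.mul_apply, ← map_mul, ← Subgroup.mem_center_iff.mp hz g, map_mul,
      Module.End.mul_apply, hv, map_smul]
  exact htop ▸ Submodule.mem_top

/-- Let `G` be a finite group and `N ≤ G` such that every element of `G` is a product
`z * n` with `z` central and `n ∈ N`.  If `ρ` is an irreducible representation of `G` on
a nonzero finite-dimensional complex vector space, then its restriction to `N` is also
irreducible. -/
theorem restriction_irreducible (G : Type*) [Group G] [Finite G] (N : Subgroup G)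
    (hGN : ∀ g : G, ∃ z ∈ Subgroup.center G, ∃ n ∈ N, g = z * n)
    (V : Type*) [AddCommGroup V] [Module ℂ V] [FiniteDimensional ℂ V] [Nontrivial V]
    (ρ : Representation ℂ G V)
    (hirr : ∀ p : Submodule ℂ V, (∀ g : G, ∀ v ∈ p, ρ g v ∈ p) → p = ⊥ ∨ p = ⊤) :
    ∀ p : Submodule ℂ V, (∀ n ∈ N, ∀ v ∈ p, ρ n v ∈ p) → p = ⊥ ∨ p = ⊤ := by
  intro p hp
  refine hirr p fun g v hv => ?_
  obtain ⟨z, hz, n, hn, rfl⟩ := hGN g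
  obtain ⟨c, hc⟩ := exists_forall_apply_eq_smul_of_mem_center ρ hirr hz
  rw [map_mul, Module.End.mul_apply, hc]
  exact p.smul_mem c (hp n hn v hv)
end

section
/- For each j ∈ {1, 2, 3, 4}, the rank of the 8×8 matrix M_j − I₈ equals 2; that is, each of the four generating matrices is a symplectic reflection on ℂ⁸. -/
open Matrix Complex

/-- The symplectic reflection `M₁`. -/
noncomputable def M1 : Matrix (Fin 8) (Fin 8) ℂ :=
  (1/2 : ℂ) • !![1, I, 0, 0, 0, 0, -1, -I;
                 -I, 1, 0, 0, 0, 0, -I, 1;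
                 0, 0, 1, I, 1, I, 0, 0;
                 0, 0, -I, 1, I, -1, 0, 0;
                 0, 0, 1, -I, 1, -I, 0, 0;
                 0, 0, -I, -1, I, 1, 0, 0;
                 -1, I, 0, 0, 0, 0, 1, -I;
                 I, 1, 0, 0, 0, 0, I, 1]

/-- The symplectic reflection `M₂`. -/
noncomputable def M2 : Matrix (Fin 8) (Fin 8) ℂ :=
  !![0, -1, 0, 0, 0, 0, 0, 0;
     -1, 0, 0, 0, 0, 0, 0, 0;
     0, 0, 1, 0, 0, 0, 0, 0;
     0, 0, 0, 1, 0, 0, 0, 0;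
     0, 0, 0, 0, 0, -1, 0, 0;
     0, 0, 0, 0, -1, 0, 0, 0;
     0, 0, 0, 0, 0, 0, 1, 0;
     0, 0, 0, 0, 0, 0, 0, 1]

/-- The symplectic reflection `M₃`. -/
noncomputable def M3 : Matrix (Fin 8) (Fin 8) ℂ :=
  !![0, 0, -1, 0, 0, 0, 0, 0;
     0, 1, 0, 0, 0, 0, 0, 0;
     -1, 0, 0, 0, 0, 0, 0, 0;
     0, 0, 0, 1, 0, 0, 0, 0;
     0, 0, 0, 0, 0, 0, -1, 0;
     0, 0, 0, 0, 0, 1, 0, 0;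
     0, 0, 0, 0, -1, 0, 0, 0;
     0, 0, 0, 0, 0, 0, 0, 1]

/-- The symplectic reflection `M₄ = diag(-1, 1, 1, 1, -1, 1, 1, 1)`. -/
noncomputable def M4 : Matrix (Fin 8) (Fin 8) ℂ :=
  !![-1, 0, 0, 0, 0, 0, 0, 0;
     0, 1, 0, 0, 0, 0, 0, 0;
     0, 0, 1, 0, 0, 0, 0, 0;
     0, 0, 0, 1, 0, 0, 0, 0;
     0, 0, 0, 0, -1, 0, 0, 0;
     0, 0, 0, 0, 0, 1, 0, 0;
     0, 0, 0, 0, 0, 0, 1, 0;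
     0, 0, 0, 0, 0, 0, 0, 1]

namespace Matrix

/-- If `C * B` is invertible, then `B * C` has rank the size of `C * B`. -/
theorem rank_mul_eq_card_of_isUnit_mul {m k R : Type*} [Fintype m] [Fintype k] [DecidableEq k]
    [CommRing R] [StrongRankCondition R] (B : Matrix m k R) (C : Matrix k m R)
    (h : IsUnit (C * B)) : (B * C).rank = Fintype.card k := by
  refine le_antisymm ((rank_mul_le_left B C).trans (rank_le_card_width B)) ?_
  calc Fintype.card k = ((C * B) * (C * B)).rank := (rank_of_isUnit _ (h.mul h)).symm
    _ = (C * ((B * C) * B)).rank := by simp only [Matrix.mul_assoc]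
    _ ≤ ((B * C) * B).rank := rank_mul_le_right _ _
    _ ≤ (B * C).rank := rank_mul_le_left _ _

/-- A matrix `1 + B * C` with `C * B = -2` is an involution whose `-1`-eigenspace has dimension
the size of `C * B`. -/
theorem rank_sub_one_eq_card_of_mul_eq_neg_two {m k K : Type*} [Fintype m] [DecidableEq m]
    [Fintype k] [DecidableEq k] [Field K] [CharZero K] {M : Matrix m m K} (B : Matrix m k K)
    (C : Matrix k m K) (hM : M = 1 + B * C) (h : C * B = (-2 : K) • 1) :
    (M - 1).rank = Fintype.card k := by
  rw [hM, add_sub_cancel_left]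
  refine rank_mul_eq_card_of_isUnit_mul B C ?_
  rw [h, isUnit_iff_isUnit_det, det_smul, det_one, mul_one]
  exact (IsUnit.mk0 (-2 : K) (by norm_num)).pow _

end Matrix

theorem rank_M1_sub_one : (M1 - 1).rank = 2 := by
  refine rank_sub_one_eq_card_of_mul_eq_neg_two
    !![1/2, 0; I/2, 0; 0, 1/2; 0, I/2; 0, -1/2; 0, I/2; 1/2, 0; -I/2, 0]
    !![-1, I, 0, 0, 0, 0, -1, -I; 0, 0, -1, I, 1, I, 0, 0] ?_ ?_
  · ext i j
    fin_cases i <;> fin_cases j <;> simp [M1] <;> ring_nf <;> simp <;> norm_num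
  · ext i j
    fin_cases i <;> fin_cases j <;> simp [Matrix.mul_apply, Fin.sum_univ_succ] <;> ring_nf <;> simp <;> norm_num

theorem rank_M2_sub_one : (M2 - 1).rank = 2 := by
  refine rank_sub_one_eq_card_of_mul_eq_neg_two
    !![-1, 0; -1, 0; 0, 0; 0, 0; 0, -1; 0, -1; 0, 0; 0, 0]
    !![1, 1, 0, 0, 0, 0, 0, 0; 0, 0, 0, 0, 1, 1, 0, 0] ?_ ?_
  · ext i j
    fin_cases i <;> fin_cases j <;> simp [M2]
  · ext i j
    fin_cases i <;> fin_cases j <;> simp [Matrix.mul_apply, Fin.sum_univ_succ] <;> ring_nf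

theorem rank_M3_sub_one : (M3 - 1).rank = 2 := by
  refine rank_sub_one_eq_card_of_mul_eq_neg_two
    !![-1, 0; 0, 0; -1, 0; 0, 0; 0, -1; 0, 0; 0, -1; 0, 0]
    !![1, 0, 1, 0, 0, 0, 0, 0; 0, 0, 0, 0, 1, 0, 1, 0] ?_ ?_
  · ext i j
    fin_cases i <;> fin_cases j <;> simp [M3]
  · ext i j
    fin_cases i <;> fin_cases j <;> simp [Matrix.mul_apply, Fin.sum_univ_succ] <;> ring_nf

theorem rank_M4_sub_one : (M4 - 1).rank = 2 := by
  refine rank_sub_one_eq_card_of_mul_eq_neg_two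
    !![-2, 0; 0, 0; 0, 0; 0, 0; 0, -2; 0, 0; 0, 0; 0, 0]
    !![1, 0, 0, 0, 0, 0, 0, 0; 0, 0, 0, 0, 1, 0, 0, 0] ?_ ?_
  · ext i j
    fin_cases i <;> fin_cases j <;> simp [M4] <;> ring_nf
  · ext i j
    fin_cases i <;> fin_cases j <;> simp [Matrix.mul_apply, Fin.sum_univ_succ]

/-- Each of the four generating matrices is a symplectic reflection on `ℂ⁸`:
`rank(Mⱼ - I₈) = 2` for `j = 1, 2, 3, 4`. -/
theorem rank_M_sub_one :
    (M1 - 1).rank = 2 ∧ (M2 - 1).rank = 2 ∧ (M3 - 1).rank = 2 ∧ (M4 - 1).rank = 2 :=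
  ⟨rank_M1_sub_one, rank_M2_sub_one, rank_M3_sub_one, rank_M4_sub_one⟩
end

section
/- The subgroup of GL₈(ℂ) generated by the matrices M₁, M₂, M₃, M₄ is finite of order 82944 = 2¹⁰·3⁴. -/
open Matrix Complex

section

open Subgroup Equiv

/-- If `g` normalises the subgroup generated by `s`, lies outside it, and has its `p`-th power in
it for a prime `p`, then adjoining `g` multiplies the order by `p`. -/
theorem Subgroup.card_closure_insert_of_prime {G : Type*} [Group G] {g : G} {s : Set G} {p : ℕ}
    (hp : p.Prime) (hconj : ∀ h ∈ s, g * h * g⁻¹ ∈ closure s) (hpow : g ^ p ∈ closure s)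
    (hg : g ∉ closure s) :
    Nat.card (closure (insert g s)) = p * Nat.card (closure s) := by
  set N := closure s with hN
  set K := closure (insert g s) with hK
  have hNK : N ≤ K := closure_mono (Set.subset_insert g s)
  have hgK : g ∈ K := subset_closure (Set.mem_insert g s)
  have hconjN : ∀ h ∈ N, g * h * g⁻¹ ∈ N := by
    have : N ≤ N.comap (MulAut.conj g).toMonoidHom := (closure_le _).2 fun h hh => hconj h hh
    exact fun h hh => this hh
  have hconjPow : ∀ (n : ℕ), ∀ h ∈ N, g ^ n * h * (g ^ n)⁻¹ ∈ N := by
    intro n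
    induction n with
    | zero => simp
    | succ n ih =>
      intro h hh
      have := hconjN _ (ih h hh)
      rw [pow_succ']
      convert this using 1
      group
  have hconjInv : ∀ h ∈ N, g⁻¹ * h * g ∈ N := by
    intro h hh
    have h1 := hconjPow (p - 1) _ (N.mul_mem (N.mul_mem (N.inv_mem hpow) hh) hpow)
    obtain ⟨q, rfl⟩ : ∃ q, p = q + 1 := ⟨p - 1, by have := hp.pos; omega⟩
    convert h1 using 1
    simp only [Nat.add_sub_cancel, pow_succ]
    group
  have hKnorm : K ≤ normalizer (N : Set G) := by
    refine (closure_le _).2 (Set.insert_subset ?_ fun h hh => le_normalizer (subset_closure hh))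
    refine mem_normalizer_iff.2 fun h => ⟨hconjN h, fun hh => ?_⟩
    convert hconjInv _ hh using 1
    group
  have : (N.subgroupOf K).Normal := normal_subgroupOf_of_le_normalizer hKnorm
  let γ : K ⧸ N.subgroupOf K := QuotientGroup.mk ⟨g, hgK⟩
  have hγ : orderOf γ = p := by
    have := Fact.mk hp
    refine orderOf_eq_prime ?_ ?_
    · exact (QuotientGroup.eq_one_iff (N := N.subgroupOf K) (⟨g, hgK⟩ ^ p)).2 hpow
    · exact fun h => hg ((QuotientGroup.eq_one_iff (N := N.subgroupOf K) ⟨g, hgK⟩).1 h)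
  have hgen : ∀ x : K ⧸ N.subgroupOf K, x ∈ zpowers γ := by
    intro x
    obtain ⟨⟨k, hk⟩, rfl⟩ := QuotientGroup.mk_surjective x
    induction hk using closure_induction with
    | mem k hk =>
      rcases hk with rfl | hk
      · exact mem_zpowers γ
      · have h1 : ((⟨k, subset_closure (Set.mem_insert_of_mem g hk)⟩ : K) :
            K ⧸ N.subgroupOf K) = 1 :=
          (QuotientGroup.eq_one_iff _).2 (subset_closure hk : k ∈ N)
        rw [h1]
        exact one_mem _
    | one => exact one_mem _
    | mul x y hx hy ihx ihy => exact mul_mem ihx ihy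
    | inv x hx ih => exact inv_mem ih
  rw [card_eq_card_quotient_mul_card_subgroup (N.subgroupOf K),
    ← orderOf_eq_card_of_forall_mem_zpowers hgen, hγ,
    Nat.card_congr (subgroupOfEquivOfLe hNK).toEquiv]

/-- The product of the entries of `l` whose positions are listed in `w`. -/
def List.word {G : Type*} [Monoid G] (l : List G) (w : List ℕ) : G :=
  (w.map fun k => l.getD k 1).prod

theorem List.word_mem_closure {G : Type*} [Group G] (l : List G) (w : List ℕ) :
    l.word w ∈ closure {h | h ∈ l} := by
  refine list_prod_mem fun x hx => ?_
  obtain ⟨k, -, rfl⟩ := List.mem_map.1 hx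
  by_cases hk : k < l.length
  · rw [List.getD_eq_getElem _ _ hk]
    exact subset_closure (List.getElem_mem hk)
  · rw [List.getD_eq_default _ _ (not_lt.1 hk)]
    exact one_mem _

theorem List.closure_le_closure_of_words {G : Type*} [Group G] {l l' : List G}
    (w : List (List ℕ)) (h : l = w.map l'.word) :
    closure {x | x ∈ l} ≤ closure {x | x ∈ l'} := by
  refine (closure_le _).2 fun x (hx : x ∈ l) => ?_
  rw [h] at hx
  obtain ⟨u, -, rfl⟩ := List.mem_map.1 hx
  exact l'.word_mem_closure u

/-- One step in computing the order of a polycyclic permutation group. The words `cw` and `pw`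
express the conjugates `g * h * g⁻¹` and the power `g ^ p` in terms of `l`, and the relation `R` is
preserved by the members of `l` but not by `g`. -/
theorem Equiv.Perm.card_closure_cons {α : Type*} {g : Perm α} {l : List (Perm α)} (p : ℕ)
    (R : α → α → Bool) (cw : List (List ℕ)) (pw : List ℕ) (hp : p.Prime)
    (hconj : (l.map fun h => g * h * g⁻¹) = cw.map l.word) (hpow : g ^ p = l.word pw)
    (hR : l.Forall fun h => ∀ x y, R (h x) (h y) = R x y) (hg : ∃ x y, R (g x) (g y) ≠ R x y) :
    Nat.card (closure {h | h ∈ g :: l}) = p * Nat.card (closure {h | h ∈ l}) := by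
  have hset : {h | h ∈ g :: l} = insert g {h | h ∈ l} := by
    ext h
    simp
  rw [hset]
  refine Subgroup.card_closure_insert_of_prime hp (fun h hh => ?_) ?_ fun hgl => ?_
  · have : g * h * g⁻¹ ∈ cw.map l.word := hconj ▸ List.mem_map_of_mem hh
    obtain ⟨u, -, hu⟩ := List.mem_map.1 this
    exact hu ▸ l.word_mem_closure u
  · exact hpow ▸ l.word_mem_closure pw
  · obtain ⟨x, y, hxy⟩ := hg
    refine hxy ?_
    have key : ∀ f ∈ closure {h | h ∈ l}, ∀ x y, R (f x) (f y) = R x y := by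
      intro f hf
      induction hf using closure_induction with
      | mem h hh => exact List.forall_iff_forall_mem.1 hR h hh
      | one => simp
      | mul f f' _ _ ih ih' => intro x y; rw [Perm.mul_apply, Perm.mul_apply, ih, ih']
      | inv f _ ih => intro x y; rw [← ih]; simp
    exact key g hgl x y

/-- A matrix is scalar as soon as it commutes with a diagonal matrix with distinct entries and
with a matrix having a row without zeros. -/
theorem Matrix.eq_smul_one_of_commute_diagonal {n K : Type*} [Fintype n] [DecidableEq n]
    [Field K] {A X : Matrix n n K} {d : n → K} (hd : Function.Injective d)
    (hA : Commute A (Matrix.diagonal d)) (hX : Commute A X) {r : n} (hr : ∀ s, X r s ≠ 0) :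
    A = A r r • 1 := by
  have hoff : ∀ s t, s ≠ t → A s t = 0 := by
    intro s t hst
    have h := congrFun (congrFun hA.eq s) t
    rw [Matrix.mul_diagonal, Matrix.diagonal_mul, mul_comm, ← sub_eq_zero, ← sub_mul] at h
    exact (mul_eq_zero.1 h).resolve_left (sub_ne_zero.2 fun e => hst (hd e).symm)
  have hdiag : A = Matrix.diagonal fun s => A s s := by
    ext s t
    by_cases hst : s = t
    · subst hst
      simp
    · rw [Matrix.diagonal_apply_ne _ hst, hoff s t hst]
  ext s t
  by_cases hst : s = t
  · subst hst
    have h := hX.eq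
    rw [hdiag] at h
    have h := congrFun (congrFun h r) s
    rw [Matrix.diagonal_mul, Matrix.mul_diagonal, mul_comm] at h
    simp [mul_left_cancel₀ (hr s) h]
  · simp [hoff s t hst, hst]

namespace WS2

/-- Labels for eighteen matrices: three commuting blocks, each consisting of the quaternion units
`i, j, k, -i, -j, -k`. -/
abbrev Label := Fin 3 × Fin 6

/-! ### The group of permutations of the labels -/

/-- A quarter turn about the third axis. -/
def quarterTurn₃ : Perm (Fin 6) := ⟨![4, 0, 2, 1, 3, 5], ![1, 3, 2, 4, 0, 5], by decide, by decide⟩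

/-- A quarter turn about the first axis. -/
def quarterTurn₁ : Perm (Fin 6) := ⟨![0, 2, 4, 3, 5, 1], ![0, 5, 1, 3, 2, 4], by decide, by decide⟩

/-- A rotation of order three. -/
def thirdTurn : Perm (Fin 6) := ⟨![2, 0, 1, 5, 3, 4], ![1, 2, 0, 4, 5, 3], by decide, by decide⟩

/-- The half turn about the first axis. -/
def halfTurn₁ : Perm (Fin 6) := ⟨![0, 4, 5, 3, 1, 2], ![0, 4, 5, 3, 1, 2], by decide, by decide⟩

/-- The half turn about the third axis. -/
def halfTurn₃ : Perm (Fin 6) := ⟨![3, 4, 2, 0, 1, 5], ![3, 4, 2, 0, 1, 5], by decide, by decide⟩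

/-- Permute the three blocks by `τ`. -/
def permBlocks (τ : Perm (Fin 3)) : Perm Label := prodCongr τ (Equiv.refl _)

/-- Act by a separate permutation inside each block. -/
def inBlocks (f₀ f₁ f₂ : Perm (Fin 6)) : Perm Label := prodCongrRight ![f₀, f₁, f₂]

/-- The permutation of the labels induced by `M₁`. -/
def σ₁ : Perm Label := permBlocks (swap 0 1)

/-- The permutation of the labels induced by `M₂`. -/
def σ₂ : Perm Label := permBlocks (swap 1 2) * inBlocks 1 quarterTurn₃ quarterTurn₃⁻¹

/-- The permutation of the labels induced by `M₃`. -/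
def σ₃ : Perm Label := permBlocks (swap 1 2) * inBlocks 1 quarterTurn₁ quarterTurn₁⁻¹

/-- The permutation of the labels induced by `M₄`. -/
def σ₄ : Perm Label := permBlocks (swap 1 2)

/-- A polycyclic generating sequence of the group generated by `σ₁, σ₂, σ₃, σ₄`. -/
def pcSequence : List (Perm Label) :=
  [permBlocks (swap 1 2), permBlocks (swap 0 1 * swap 1 2),
    inBlocks quarterTurn₃ quarterTurn₃⁻¹ 1, inBlocks 1 quarterTurn₃ quarterTurn₃⁻¹,
    inBlocks thirdTurn 1 1, inBlocks 1 thirdTurn 1, inBlocks 1 1 thirdTurn,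
    inBlocks halfTurn₁ 1 1, inBlocks halfTurn₃ 1 1, inBlocks 1 halfTurn₁ 1,
    inBlocks 1 halfTurn₃ 1, inBlocks 1 1 halfTurn₁, inBlocks 1 1 halfTurn₃]

theorem closure_pcSequence :
    closure {h | h ∈ pcSequence} = closure {h | h ∈ [σ₁, σ₂, σ₃, σ₄]} := by
  refine le_antisymm
    (List.closure_le_closure_of_words
      [[3], [0, 3], [0, 3, 0, 1, 0, 3], [3, 1], [0, 1, 3, 2, 1, 0, 3, 1, 0, 2, 3, 0, 1, 3],
        [0, 1, 3, 0, 1, 3, 2, 1, 0, 3, 1, 0, 2, 3], [0, 1, 0, 2, 0, 3, 0, 2, 1, 0, 3, 2],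
        [0, 1, 3, 1, 0, 2, 3, 0, 1, 3, 1, 2, 0, 3, 0, 2],
        [0, 1, 0, 2, 3, 2, 3, 0, 1, 2, 0, 3, 2, 3, 0, 2],
        [0, 1, 0, 2, 0, 1, 3, 1, 3, 0, 2, 1, 0, 3, 1, 3],
        [0, 1, 0, 2, 3, 2, 0, 1, 3, 0, 1, 2, 3, 2, 0, 3],
        [0, 1, 0, 2, 0, 3, 1, 3, 0, 2, 1, 0, 3, 1, 3, 2],
        [0, 1, 0, 2, 0, 3, 1, 2, 3, 0, 2, 1, 0, 3, 2, 3]] ?_)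
    (List.closure_le_closure_of_words [[1, 0], [0, 3], [0, 5, 6, 9, 3], [0]] ?_) <;>
  decide +kernel

theorem card_closure_pcSequence : Nat.card (closure {h | h ∈ pcSequence}) = 41472 := by
  unfold pcSequence
  rw [Perm.card_closure_cons 2 (fun x y => y.1 = x.1 + 1)
      [[0, 0], [1, 2], [2, 2, 2], [3], [5], [4], [6], [7], [10], [11], [8], [9]] [],
    Perm.card_closure_cons 3 (fun x _ => x.1 = 0)
      [[1], [0, 1, 6, 10], [3], [4], [2], [7], [8], [9], [10], [5], [6]] [],
    Perm.card_closure_cons 2 (fun x y => x.1 = 0 ∧ y.1 = 0 ∧ y.2.1 % 3 = (x.2.1 + 1) % 3)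
      [[0], [1, 1, 5], [2, 6, 2], [3], [4, 5], [5], [6, 7], [7], [8], [9]] [5, 7],
    Perm.card_closure_cons 2 (fun x y => x.1 = 2 ∧ y.1 = 2 ∧ y.2.1 % 3 = (x.2.1 + 1) % 3)
      [[0], [1, 1, 6], [2, 7, 2], [3], [4], [5, 6], [6], [7, 8], [8]] [6, 8],
    Perm.card_closure_cons 3 (fun x _ => x.1 = 0 ∧ x.2.1 % 3 = 0)
      [[0], [1], [3], [2, 3], [4], [5], [6], [7]] [],
    Perm.card_closure_cons 3 (fun x _ => x.1 = 1 ∧ x.2.1 % 3 = 0)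
      [[0], [1], [2], [4], [3, 4], [5], [6]] [],
    Perm.card_closure_cons 3 (fun x _ => x.1 = 2 ∧ x.2.1 % 3 = 0)
      [[0], [1], [2], [3], [5], [4, 5]] [],
    Perm.card_closure_cons 2 (fun x _ => x = (0, 2)) [[0], [1], [2], [3], [4]] [],
    Perm.card_closure_cons 2 (fun x _ => x = (0, 0)) [[0], [1], [2], [3]] [],
    Perm.card_closure_cons 2 (fun x _ => x = (1, 2)) [[0], [1], [2]] [],
    Perm.card_closure_cons 2 (fun x _ => x = (1, 0)) [[0], [1]] [],
    Perm.card_closure_cons 2 (fun x _ => x = (2, 2)) [[0]] [],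
    Perm.card_closure_cons 2 (fun x _ => x = (2, 0)) [] []]
  · simp
  all_goals decide +kernel

theorem card_closure_σ :
    Nat.card (closure ({σ₁, σ₂, σ₃, σ₄} : Set (Perm Label))) = 41472 := by
  have : ({σ₁, σ₂, σ₃, σ₄} : Set (Perm Label)) = {h | h ∈ [σ₁, σ₂, σ₃, σ₄]} := by
    ext h
    simp
  rw [this, ← closure_pcSequence, card_closure_pcSequence]

/-! ### The label matrices -/

/-- The imaginary unit of the Gaussian integers. -/
def 𝕚 : GaussianInt := ⟨0, 1⟩

theorem toComplex_𝕚 : GaussianInt.toComplex 𝕚 = I := by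
  simp [𝕚, GaussianInt.toComplex_def']

/-- The entrywise embedding of matrices over the Gaussian integers into complex matrices. -/
def φ : Matrix (Fin 8) (Fin 8) GaussianInt →+* Matrix (Fin 8) (Fin 8) ℂ :=
  GaussianInt.toComplex.mapMatrix

theorem φ_apply (A : Matrix (Fin 8) (Fin 8) GaussianInt) (r s : Fin 8) :
    φ A r s = GaussianInt.toComplex (A r s) := rfl

theorem φ_injective : Function.Injective φ := fun _ _ h =>
  Matrix.map_injective GaussianInt.toComplex_injective h

theorem φ_transpose (A : Matrix (Fin 8) (Fin 8) GaussianInt) : φ Aᵀ = (φ A)ᵀ := rfl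

/-- The matrix whose only nonzero entry in row `r` is `c r`, in column `r ^^^ m`. -/
def xorMatrix (m : Fin 8) (c : Fin 8 → GaussianInt) : Matrix (Fin 8) (Fin 8) GaussianInt :=
  Matrix.of fun r s => if s = r ^^^ m then c r else 0

/-- Three commuting triples of anticommuting square roots of `-1`. -/
def unitMatrix : Fin 3 → Fin 3 → Matrix (Fin 8) (Fin 8) GaussianInt :=
  ![![xorMatrix 4 ![1, 1, 1, 1, -1, -1, -1, -1],
      xorMatrix 4 fun _ => 𝕚,
      xorMatrix 0 ![𝕚, 𝕚, 𝕚, 𝕚, -𝕚, -𝕚, -𝕚, -𝕚]],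
    ![xorMatrix 2 ![1, -1, -1, 1, 1, -1, -1, 1],
      xorMatrix 3 ![1, 1, -1, -1, 1, 1, -1, -1],
      xorMatrix 1 ![-1, 1, -1, 1, -1, 1, -1, 1]],
    ![xorMatrix 2 ![-1, -1, 1, 1, -1, -1, 1, 1],
      xorMatrix 3 ![-1, 1, -1, 1, -1, 1, -1, 1],
      xorMatrix 1 ![1, -1, -1, 1, 1, -1, -1, 1]]]

/-- The matrix attached to a label. -/
def labelMatrix (x : Label) : Matrix (Fin 8) (Fin 8) GaussianInt :=
  ![unitMatrix x.1 0, unitMatrix x.1 1, unitMatrix x.1 2,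
    -unitMatrix x.1 0, -unitMatrix x.1 1, -unitMatrix x.1 2] x.2

theorem labelMatrix_injective : Function.Injective labelMatrix := by
  have : ∀ x y, labelMatrix x = labelMatrix y → x = y := by decide +kernel
  exact fun x y => this x y

/-- The matrix of the symplectic form preserved by the group. -/
def J : Matrix (Fin 8) (Fin 8) GaussianInt := labelMatrix (0, 0)

/-- The double of `M₁`, with Gaussian integer entries. -/
def N₁ : Matrix (Fin 8) (Fin 8) GaussianInt :=
  !![1, 𝕚, 0, 0, 0, 0, -1, -𝕚;
     -𝕚, 1, 0, 0, 0, 0, -𝕚, 1;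
     0, 0, 1, 𝕚, 1, 𝕚, 0, 0;
     0, 0, -𝕚, 1, 𝕚, -1, 0, 0;
     0, 0, 1, -𝕚, 1, -𝕚, 0, 0;
     0, 0, -𝕚, -1, 𝕚, 1, 0, 0;
     -1, 𝕚, 0, 0, 0, 0, 1, -𝕚;
     𝕚, 1, 0, 0, 0, 0, 𝕚, 1]

/-- `M₂` over the Gaussian integers. -/
def N₂ : Matrix (Fin 8) (Fin 8) GaussianInt :=
  !![0, -1, 0, 0, 0, 0, 0, 0;
     -1, 0, 0, 0, 0, 0, 0, 0;
     0, 0, 1, 0, 0, 0, 0, 0;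
     0, 0, 0, 1, 0, 0, 0, 0;
     0, 0, 0, 0, 0, -1, 0, 0;
     0, 0, 0, 0, -1, 0, 0, 0;
     0, 0, 0, 0, 0, 0, 1, 0;
     0, 0, 0, 0, 0, 0, 0, 1]

/-- `M₃` over the Gaussian integers. -/
def N₃ : Matrix (Fin 8) (Fin 8) GaussianInt :=
  !![0, 0, -1, 0, 0, 0, 0, 0;
     0, 1, 0, 0, 0, 0, 0, 0;
     -1, 0, 0, 0, 0, 0, 0, 0;
     0, 0, 0, 1, 0, 0, 0, 0;
     0, 0, 0, 0, 0, 0, -1, 0;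
     0, 0, 0, 0, 0, 1, 0, 0;
     0, 0, 0, 0, -1, 0, 0, 0;
     0, 0, 0, 0, 0, 0, 0, 1]

/-- `M₄` over the Gaussian integers. -/
def N₄ : Matrix (Fin 8) (Fin 8) GaussianInt := Matrix.diagonal ![-1, 1, 1, 1, -1, 1, 1, 1]

theorem φ_N₁ : (1 / 2 : ℂ) • φ N₁ = M1 := by
  unfold M1
  congr 1
  ext r s
  fin_cases r <;> fin_cases s <;> simp [φ_apply, N₁, toComplex_𝕚]

theorem φ_N₂ : φ N₂ = M2 := by
  ext r s
  fin_cases r <;> fin_cases s <;> simp [φ_apply, N₂, M2]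

theorem φ_N₃ : φ N₃ = M3 := by
  ext r s
  fin_cases r <;> fin_cases s <;> simp [φ_apply, N₃, M3]

theorem φ_N₄ : φ N₄ = M4 := by
  ext r s
  fin_cases r <;> fin_cases s <;> simp [φ_apply, N₄, M4]

/-! ### The group of pairs of a matrix and the induced permutation of labels -/

/-- The pairs consisting of a matrix preserving the form `J` and a permutation of the labels
induced by conjugation with that matrix. -/
def inducing : Subgroup (GL (Fin 8) ℂ × Perm Label) where
  carrier := {q | (∀ x, q.1.val * φ (labelMatrix x) = φ (labelMatrix (q.2 x)) * q.1.val) ∧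
    q.1.valᵀ * φ J * q.1.val = φ J}
  mul_mem' := by
    rintro ⟨g, σ⟩ ⟨h, τ⟩ ⟨hg, hgJ⟩ ⟨hh, hhJ⟩
    refine ⟨fun x => ?_, ?_⟩
    · simp only [Prod.mk_mul_mk, Units.val_mul, Perm.mul_apply] at hg hh ⊢
      rw [mul_assoc, hh, ← mul_assoc, hg, mul_assoc]
    · simp only [Prod.mk_mul_mk, Units.val_mul, Matrix.transpose_mul] at hgJ hhJ ⊢
      calc _ = h.valᵀ * (g.valᵀ * φ J * g.val) * h.val := by simp only [mul_assoc]
        _ = _ := by rw [hgJ, hhJ]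
  one_mem' := by simp
  inv_mem' := by
    rintro ⟨g, σ⟩ ⟨hg, hgJ⟩
    refine ⟨fun x => ?_, ?_⟩
    · have h := hg (σ⁻¹ x)
      rw [show σ (σ⁻¹ x) = x from σ.apply_symm_apply x] at h
      change (g⁻¹).val * _ = _ * (g⁻¹).val
      rw [Units.inv_mul_eq_iff_eq_mul, ← mul_assoc]
      change φ (labelMatrix x) = g.val * φ (labelMatrix (σ⁻¹ x)) * (g⁻¹).val
      rw [h, mul_assoc, Units.mul_inv, mul_one]
    · simp only [Prod.fst_inv] at hgJ ⊢
      have hT : (g⁻¹).valᵀ * g.valᵀ = 1 := by rw [← Matrix.transpose_mul]; simp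
      calc _ = (g⁻¹).valᵀ * (g.valᵀ * φ J * g.val) * (g⁻¹).val := by rw [hgJ]
        _ = ((g⁻¹).valᵀ * g.valᵀ) * φ J * (g.val * (g⁻¹).val) := by simp only [mul_assoc]
        _ = φ J := by rw [hT]; simp

theorem mem_inducing {g : GL (Fin 8) ℂ} {σ : Perm Label} {c : ℂ}
    {N : Matrix (Fin 8) (Fin 8) GaussianInt} {n : GaussianInt} (hg : g.val = c • φ N)
    (hN : ∀ x, N * labelMatrix x = labelMatrix (σ x) * N) (hJ : Nᵀ * J * N = n • J)
    (hc : c ^ 2 * GaussianInt.toComplex n = 1) : (g, σ) ∈ inducing := by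
  refine ⟨fun x => ?_, ?_⟩
  · change g.val * _ = _ * g.val
    rw [hg, smul_mul_assoc, mul_smul_comm, ← map_mul, ← map_mul, hN]
  · change g.valᵀ * _ * g.val = _
    have h := congrArg φ hJ
    have hsmul : φ (n • J) = GaussianInt.toComplex n • φ J := by
      ext r s
      simp [φ_apply]
    rw [map_mul, map_mul, φ_transpose, hsmul] at h
    rw [hg, Matrix.transpose_smul, smul_mul_assoc, smul_mul_assoc, mul_smul_comm, h, smul_smul,
      smul_smul, ← pow_two, hc, one_smul]

theorem eq_smul_one_of_commute {A : Matrix (Fin 8) (Fin 8) ℂ}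
    (hA : ∀ x, Commute A (φ (labelMatrix x))) : ∃ c : ℂ, A = c • 1 := by
  have hu : ∀ b a, Commute A (φ (unitMatrix b a)) := by
    intro b a
    fin_cases a
    exacts [hA (b, 0), hA (b, 1), hA (b, 2)]
  let d : Fin 8 → GaussianInt := ![3 + 𝕚, 1 + 𝕚, -1 + 𝕚, -3 + 𝕚, 3 - 𝕚, 1 - 𝕚, -1 - 𝕚, -3 - 𝕚]
  have hD : Commute A (Matrix.diagonal (GaussianInt.toComplex ∘ d)) := by
    have hd : Matrix.diagonal d = unitMatrix 0 2 + unitMatrix 1 0 * unitMatrix 2 0 +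
        (unitMatrix 1 2 * unitMatrix 2 2 + unitMatrix 1 2 * unitMatrix 2 2) := by decide +kernel
    have hφ : Matrix.diagonal (GaussianInt.toComplex ∘ d) = φ (Matrix.diagonal d) :=
      (Matrix.diagonal_map (map_zero _)).symm
    rw [hφ, hd]
    simp only [map_add, map_mul]
    exact ((hu 0 2).add_right ((hu 1 0).mul_right (hu 2 0))).add_right
      (((hu 1 2).mul_right (hu 2 2)).add_right ((hu 1 2).mul_right (hu 2 2)))
  have hX : Commute A (φ ((unitMatrix 0 2 + unitMatrix 0 0) * (1 + unitMatrix 1 0) *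
      (1 + unitMatrix 1 2))) := by
    simp only [map_add, map_mul, map_one]
    exact (((hu 0 2).add_right (hu 0 0)).mul_right
      ((Commute.one_right A).add_right (hu 1 0))).mul_right
        ((Commute.one_right A).add_right (hu 1 2))
  have hd : ∀ s t, d s = d t → s = t := by decide +kernel
  have hrow : ∀ s, ((unitMatrix 0 2 + unitMatrix 0 0) * (1 + unitMatrix 1 0) *
      (1 + unitMatrix 1 2)) 0 s ≠ 0 := by decide +kernel
  exact ⟨_, Matrix.eq_smul_one_of_commute_diagonal
    (fun s t hst => hd s t (GaussianInt.toComplex_injective hst)) hD hX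
    fun s => (map_ne_zero_iff _ GaussianInt.toComplex_injective).2 (hrow s)⟩

theorem eq_one_of_one_mem_inducing {σ : Perm Label} (h : (1, σ) ∈ inducing) : σ = 1 := by
  ext1 x
  have hx : (1 : Matrix (Fin 8) (Fin 8) ℂ) * φ (labelMatrix x) = φ (labelMatrix (σ x)) * 1 := h.1 x
  rw [one_mul, mul_one] at hx
  exact (labelMatrix_injective (φ_injective hx)).symm

theorem eq_or_eq_neg_of_mem_inducing {g : GL (Fin 8) ℂ} (h : (g, 1) ∈ inducing) :
    g = 1 ∨ g = -1 := by
  obtain ⟨hg, hJ⟩ := h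
  obtain ⟨c, hc⟩ := eq_smul_one_of_commute (A := g.val) hg
  have hJ : g.valᵀ * φ J * g.val = φ J := hJ
  rw [hc, Matrix.transpose_smul, Matrix.transpose_one, smul_mul_assoc, smul_mul_assoc,
    mul_smul_comm, smul_smul, one_mul, mul_one] at hJ
  have hJ₁ : J 0 4 = 1 := by decide +kernel
  have h04 : c * c = 1 := by
    simpa [φ_apply, hJ₁] using congrFun (congrFun hJ 0) 4
  rcases mul_self_eq_one_iff.1 h04 with rfl | rfl
  · exact Or.inl (Units.ext (by simpa using hc))
  · exact Or.inr (Units.ext (by simpa using hc))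

/-- A matrix that is its own inverse, as a unit. -/
def involution (A : Matrix (Fin 8) (Fin 8) ℂ) (hA : A * A = 1) : GL (Fin 8) ℂ := ⟨A, A, hA, hA⟩

theorem M1_mul_self : M1 * M1 = 1 := by
  have h : N₁ * N₁ = 2 + 2 := by decide +kernel
  have h4 : φ (2 + 2) = (4 : ℂ) • 1 := by
    rw [← one_add_one_eq_two, map_add, map_add, map_one]
    module
  rw [← φ_N₁, smul_mul_assoc, mul_smul_comm, smul_smul, ← map_mul, h, h4, smul_smul]
  norm_num

theorem M2_mul_self : M2 * M2 = 1 := by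
  have h : N₂ * N₂ = 1 := by decide +kernel
  rw [← φ_N₂, ← map_mul, h, map_one]

theorem M3_mul_self : M3 * M3 = 1 := by
  have h : N₃ * N₃ = 1 := by decide +kernel
  rw [← φ_N₃, ← map_mul, h, map_one]

theorem M4_mul_self : M4 * M4 = 1 := by
  have h : N₄ * N₄ = 1 := by decide +kernel
  rw [← φ_N₄, ← map_mul, h, map_one]

theorem M1_mem_inducing : (involution M1 M1_mul_self, σ₁) ∈ inducing :=
  mem_inducing (n := 4) φ_N₁.symm (by decide +kernel) (by decide +kernel)
    (by rw [map_ofNat]; norm_num)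

theorem mem_inducing_of_eq {g : GL (Fin 8) ℂ} {σ : Perm Label}
    {N : Matrix (Fin 8) (Fin 8) GaussianInt} (hg : φ N = g.val)
    (hN : ∀ x, N * labelMatrix x = labelMatrix (σ x) * N) (hJ : Nᵀ * J * N = J) :
    (g, σ) ∈ inducing :=
  mem_inducing (c := 1) (n := 1) (by rw [one_smul, hg]) hN (by rw [hJ, one_smul]) (by simp)

theorem M2_mem_inducing : (involution M2 M2_mul_self, σ₂) ∈ inducing :=
  mem_inducing_of_eq φ_N₂ (by decide +kernel) (by decide +kernel)

theorem M3_mem_inducing : (involution M3 M3_mul_self, σ₃) ∈ inducing :=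
  mem_inducing_of_eq φ_N₃ (by decide +kernel) (by decide +kernel)

theorem M4_mem_inducing : (involution M4 M4_mul_self, σ₄) ∈ inducing :=
  mem_inducing_of_eq φ_N₄ (by decide +kernel) (by decide +kernel)

/-- A subgroup of `inducing` contains `(-1, 1)` as soon as it induces the half turn `p`, because
the matrices inducing `p` are `J` and `-J`, which square to `-1`. -/
theorem neg_one_mem {K : Subgroup (GL (Fin 8) ℂ × Perm Label)} (hK : K ≤ inducing)
    {g : GL (Fin 8) ℂ} (hg : (g, inBlocks halfTurn₁ 1 1) ∈ K) : (-1, 1) ∈ K := by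
  have hJJ : J * -J = 1 := by decide +kernel
  have hJJ' : φ J * φ (-J) = 1 := by rw [← map_mul, hJJ, map_one]
  let u : GL (Fin 8) ℂ := ⟨φ J, φ (-J), hJJ', by rw [← map_mul, neg_mul_comm, hJJ, map_one]⟩
  have hu : (u, inBlocks halfTurn₁ 1 1) ∈ inducing :=
    mem_inducing_of_eq (N := J) rfl (by decide +kernel) (by decide +kernel)
  have huu : u * u = -1 := Units.ext <| by
    change φ J * φ J = -1
    rw [← hJJ', map_neg, mul_neg, neg_neg]
  have hp : inBlocks halfTurn₁ 1 1 * inBlocks halfTurn₁ 1 1 = 1 := by decide +kernel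
  have hgu : (u⁻¹ * g, 1) ∈ inducing := by
    simpa using mul_mem (inv_mem hu) (hK hg)
  have hgg : g * g = -1 := by
    rcases eq_or_eq_neg_of_mem_inducing hgu with h | h
    · rw [inv_mul_eq_one.1 h] at huu
      exact huu
    · rw [inv_mul_eq_iff_eq_mul] at h
      rw [h, mul_neg_one, neg_mul_neg, huu]
  simpa [hgg, hp] using mul_mem hg hg

/-- A subgroup of `inducing` that contains `(-1, 1)` has twice as many matrices as induced
permutations. -/
theorem card_map_fst {K : Subgroup (GL (Fin 8) ℂ × Perm Label)} (hK : K ≤ inducing)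
    (hneg : (-1, 1) ∈ K) :
    Nat.card (K.map (MonoidHom.fst (GL (Fin 8) ℂ) (Perm Label))) =
      2 * Nat.card (K.map (MonoidHom.snd (GL (Fin 8) ℂ) (Perm Label))) := by
  let f := (MonoidHom.fst (GL (Fin 8) ℂ) (Perm Label)).domRestrict K
  let s := (MonoidHom.snd (GL (Fin 8) ℂ) (Perm Label)).domRestrict K
  have hf : Function.Injective f := by
    refine (injective_iff_map_eq_one f).2 ?_
    rintro ⟨⟨g, σ⟩, hx⟩ (rfl : g = 1)
    obtain rfl := eq_one_of_one_mem_inducing (hK hx)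
    rfl
  have hs : Nat.card s.ker = 2 := by
    refine Nat.card_eq_two_iff.2 ⟨1, ⟨⟨(-1, 1), hneg⟩, rfl⟩, ?_, ?_⟩
    · intro h
      have h : (1 : Matrix (Fin 8) (Fin 8) ℂ) 0 0 = (-1 : Matrix (Fin 8) (Fin 8) ℂ) 0 0 :=
        congrArg (fun x : s.ker => x.1.1.1.val 0 0) h
      norm_num at h
    · refine Set.eq_univ_of_forall ?_
      rintro ⟨⟨⟨g, σ⟩, hx⟩, (rfl : σ = 1)⟩
      rcases eq_or_eq_neg_of_mem_inducing (hK hx) with rfl | rfl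
      · exact Or.inl rfl
      · exact Or.inr rfl
  rw [← MonoidHom.domRestrict_range, ← MonoidHom.domRestrict_range, ← hs,
    ← index_ker s, s.ker.card_mul_index]
  exact (Nat.card_congr (MonoidHom.ofInjective hf).toEquiv).symm

/-- The pairs of the generating matrices with the permutations they induce. -/
def generatingPairs : Set (GL (Fin 8) ℂ × Perm Label) :=
  {(involution M1 M1_mul_self, σ₁), (involution M2 M2_mul_self, σ₂),
    (involution M3 M3_mul_self, σ₃), (involution M4 M4_mul_self, σ₄)}

theorem card_closure_involution :
    Nat.card (Subgroup.closure ({involution M1 M1_mul_self, involution M2 M2_mul_self,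
      involution M3 M3_mul_self, involution M4 M4_mul_self} : Set (GL (Fin 8) ℂ))) = 82944 := by
  have hK : closure generatingPairs ≤ inducing := by
    rw [closure_le]
    rintro x (rfl | rfl | rfl | rfl)
    exacts [M1_mem_inducing, M2_mem_inducing, M3_mem_inducing, M4_mem_inducing]
  have hfst := (MonoidHom.fst (GL (Fin 8) ℂ) (Perm Label)).map_closure generatingPairs
  have hsnd := (MonoidHom.snd (GL (Fin 8) ℂ) (Perm Label)).map_closure generatingPairs
  nth_rw 2 [generatingPairs] at hfst hsnd
  simp only [Set.image_insert_eq, Set.image_singleton, MonoidHom.coe_fst, MonoidHom.coe_snd]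
    at hfst hsnd
  have hp : inBlocks halfTurn₁ 1 1 ∈ closure ({σ₁, σ₂, σ₃, σ₄} : Set (Perm Label)) := by
    have h : inBlocks halfTurn₁ 1 1 ∈ closure {h | h ∈ pcSequence} :=
      subset_closure (by simp [pcSequence])
    simp only [closure_pcSequence, List.mem_cons, List.not_mem_nil, or_false] at h
    exact h
  rw [← hsnd] at hp
  obtain ⟨⟨g, -⟩, hg, rfl⟩ := hp
  rw [← hfst, card_map_fst hK (neg_one_mem hK hg), hsnd, card_closure_σ]

end WS2

end

/-- The subgroup of `GL₈(ℂ)` generated by `M₁`, `M₂`, `M₃`, `M₄` is finite of order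
`82944 = 2¹⁰ · 3⁴`. -/
theorem card_group_WS2 :
    ∃ u1 u2 u3 u4 : GL (Fin 8) ℂ,
      (u1 : Matrix (Fin 8) (Fin 8) ℂ) = M1 ∧
      (u2 : Matrix (Fin 8) (Fin 8) ℂ) = M2 ∧
      (u3 : Matrix (Fin 8) (Fin 8) ℂ) = M3 ∧
      (u4 : Matrix (Fin 8) (Fin 8) ℂ) = M4 ∧
      Nat.card (Subgroup.closure {u1, u2, u3, u4} : Subgroup (GL (Fin 8) ℂ))
        = 82944 := by
  exact ⟨WS2.involution M1 WS2.M1_mul_self, WS2.involution M2 WS2.M2_mul_self,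
    WS2.involution M3 WS2.M3_mul_self, WS2.involution M4 WS2.M4_mul_self, rfl, rfl, rfl, rfl,
    WS2.card_closure_involution⟩
end
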